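/- arXiv:1111.4019 — 2 statements merged into one kernel-verified Lean document; each statement's English description precedes it below -/
import Mathlib

section
/- Let λ ∈ ℂ with 0 < |λ| < 1, let ω ∈ ℝ be irrational, let k ≥ 2 be an integer, and define α n = λ·e(ω·n^k) for n ∈ ℕ. Let 𝒞 be the half-line CMV operator associated with α. Then the spectrum of 𝒞 is the whole unit circle: spectrum(𝒞) = {z ∈ ℂ : |z| = 1}. -/
open scoped ComplexConjugate

noncomputable section

/-- `e t = exp(2πi t)`. -/
def e (t : ℝ) : ℂ := Complex.exp (2 * Real.pi * Complex.I * t)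

/-- `ρ n = (1 - |α n|^2)^{1/2}`, as a complex number. -/
def rhoN (α : ℕ → ℂ) (n : ℕ) : ℂ := ((1 - ‖α n‖ ^ 2).sqrt : ℝ)

open Filter Topology

section PolynomialOrbits

variable {G : Type*} [SeminormedAddCommGroup G]

/-- Expansion of `(a + m) ^ s • w` when the points `m ^ j • w`, `1 ≤ j ≤ s`, are close to `z j`. -/
lemma norm_add_pow_nsmul_sub_le (w : G) (z : ℕ → G) (a m : ℕ) {s : ℕ} (hs : 1 ≤ s) {δ : ℝ}
    (hz : ∀ j ∈ Finset.Icc 1 s, ‖m ^ j • w - z j‖ ≤ δ) :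
    ‖(a + m) ^ s • w - a ^ s • w - ∑ j ∈ Finset.Icc 1 s, (a ^ (s - j) * s.choose j) • z j‖
      ≤ ((a : ℝ) + 1) ^ s * δ := by
  have hr : Finset.range (s + 1) = insert 0 (Finset.Icc 1 s) := by
    ext; simp; omega
  have h1 : (a + m) ^ s • w - a ^ s • w
      = ∑ j ∈ Finset.Icc 1 s, (a ^ (s - j) * s.choose j) • (m ^ j • w) := by
    rw [sub_eq_iff_eq_add', add_comm a m, add_pow, hr, Finset.sum_insert (by simp), add_smul,
      Finset.sum_smul]
    simp only [pow_zero, one_mul, Nat.sub_zero, Nat.choose_zero_right, Nat.cast_one, mul_one]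
    congr 1
    refine Finset.sum_congr rfl fun j _ => ?_
    rw [← mul_smul]
    congr 1
    simp only [Nat.cast_id]
    ring
  rw [h1, ← Finset.sum_sub_distrib]
  have h2 : ((a : ℝ) + 1) ^ s = a ^ s + ∑ j ∈ Finset.Icc 1 s, ((a ^ (s - j) * s.choose j : ℕ) : ℝ) := by
    rw [add_comm (a : ℝ) 1, add_pow, hr, Finset.sum_insert (by simp)]
    simp
  have hδ : 0 ≤ δ := (norm_nonneg _).trans (hz 1 (by simp; omega))
  calc _ ≤ ∑ j ∈ Finset.Icc 1 s, ((a ^ (s - j) * s.choose j : ℕ) : ℝ) * δ := by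
        refine norm_sum_le_of_le _ fun j hj => ?_
        rw [← smul_sub]
        exact norm_nsmul_le.trans (mul_le_mul_of_nonneg_left (hz j hj) (Nat.cast_nonneg _))
    _ ≤ _ := by
        rw [← Finset.sum_mul, h2]
        gcongr
        simp

/-- The points `(n • w, n ^ 2 • w, …, n ^ d • w)`, with `n` large, are dense in `G ^ d`. -/
def DensePowers (w : G) (d : ℕ) : Prop :=
  ∀ x : ℕ → G, ∀ ε > 0, ∀ A : ℕ, ∃ n ≥ A, ∀ s ∈ Finset.Icc 1 d, ‖n ^ s • w - x s‖ < ε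

/-- `(0, …, 0, θ)` is a limit point of the points `(n • w, …, n ^ D • w, n ^ (D + 1) • w)`. -/
def IsTopLimit (w : G) (D : ℕ) (θ : G) : Prop :=
  ∀ ε > 0, ∀ A : ℕ, ∃ n ≥ A, (∀ s ∈ Finset.Icc 1 D, ‖n ^ s • w‖ < ε) ∧ ‖n ^ (D + 1) • w - θ‖ < ε

lemma IsTopLimit.exists_shift {w θ : G} {D : ℕ} (h : IsTopLimit w D θ) (a : ℕ) {ε : ℝ}
    (hε : 0 < ε) (A : ℕ) :
    ∃ n ≥ A, (∀ s ∈ Finset.Icc 1 D, ‖n ^ s • w - a ^ s • w‖ < ε) ∧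
      ‖n ^ (D + 1) • w - a ^ (D + 1) • w - θ‖ < ε := by
  obtain ⟨δ, hδ, hδε⟩ : ∃ δ > 0, ((a : ℝ) + 1) ^ (D + 1) * δ < ε := by
    refine ⟨ε / (2 * ((a : ℝ) + 1) ^ (D + 1)), by positivity, ?_⟩
    field_simp
    linarith
  obtain ⟨m, hm, hlow, htop⟩ := h δ hδ A
  refine ⟨a + m, by omega, fun s hs => ?_, ?_⟩
  · have := norm_add_pow_nsmul_sub_le w (fun _ => 0) a m (Finset.mem_Icc.1 hs).1 (δ := δ) fun j hj => by
      rw [sub_zero]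
      exact (hlow j (by simp only [Finset.mem_Icc] at *; omega)).le
    simp only [smul_zero, Finset.sum_const_zero, sub_zero] at this
    refine this.trans_lt (lt_of_le_of_lt ?_ hδε)
    gcongr
    · linarith [Nat.cast_nonneg (α := ℝ) a]
    · simp only [Finset.mem_Icc] at hs; omega
  · have := norm_add_pow_nsmul_sub_le w (fun j => if j = D + 1 then θ else 0) a m (Nat.le_add_left 1 D)
      (δ := δ)
      fun j hj => by
        split_ifs with hjD
        · rw [hjD]; exact htop.le
        · rw [sub_zero]
          exact (hlow j (by simp only [Finset.mem_Icc] at *; omega)).le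
    rw [Finset.sum_eq_single (D + 1) (fun j _ hj => by simp [hj]) (by simp)] at this
    simp only [if_true, Nat.sub_self, pow_zero, Nat.choose_self, mul_one, one_smul] at this
    exact this.trans_lt hδε

lemma IsTopLimit.add {w θ₁ θ₂ : G} {D : ℕ} (h₁ : IsTopLimit w D θ₁) (h₂ : IsTopLimit w D θ₂) :
    IsTopLimit w D (θ₁ + θ₂) := by
  intro ε hε A
  obtain ⟨a, -, halow, hatop⟩ := h₁ (ε / 2) (half_pos hε) 0
  obtain ⟨n, hn, hlow, htop⟩ := h₂.exists_shift a (half_pos hε) A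
  refine ⟨n, hn, fun s hs => ?_, ?_⟩
  · have := norm_add_le (n ^ s • w - a ^ s • w) (a ^ s • w)
    rw [sub_add_cancel] at this
    linarith [hlow s hs, halow s hs]
  · have := norm_add_le (n ^ (D + 1) • w - a ^ (D + 1) • w - θ₂) (a ^ (D + 1) • w - θ₁)
    rw [show n ^ (D + 1) • w - a ^ (D + 1) • w - θ₂ + (a ^ (D + 1) • w - θ₁)
      = n ^ (D + 1) • w - (θ₁ + θ₂) by abel] at this
    linarith

lemma IsTopLimit.of_forall_near {w θ : G} {D : ℕ}
    (h : ∀ ε > 0, ∃ θ', IsTopLimit w D θ' ∧ ‖θ' - θ‖ < ε) : IsTopLimit w D θ := by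
  intro ε hε A
  obtain ⟨θ', hθ', hnear⟩ := h (ε / 2) (half_pos hε)
  obtain ⟨n, hn, hlow, htop⟩ := hθ' (ε / 2) (half_pos hε) A
  refine ⟨n, hn, fun s hs => (hlow s hs).trans (half_lt_self hε), ?_⟩
  have := norm_add_le (n ^ (D + 1) • w - θ') (θ' - θ)
  rw [sub_add_sub_cancel] at this
  linarith

lemma IsTopLimit.nsmul_succ {w θ : G} {D : ℕ} (h : IsTopLimit w D θ) (n : ℕ) :
    IsTopLimit w D ((n + 1) • θ) := by
  induction n with
  | zero => simpa using h
  | succ n ih => rw [succ_nsmul]; exact ih.add h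

lemma IsTopLimit.of_tendsto {w θ : G} {D : ℕ} {q : ℕ → ℕ} (hq : Tendsto q atTop atTop)
    (hlow : ∀ s ∈ Finset.Icc 1 D, Tendsto (fun i => q i ^ s • w) atTop (𝓝 0))
    (htop : Tendsto (fun i => q i ^ (D + 1) • w) atTop (𝓝 θ)) : IsTopLimit w D θ := by
  intro ε hε A
  have h1 : ∀ᶠ i in atTop, ∀ s ∈ Finset.Icc 1 D, ‖q i ^ s • w‖ < ε := by
    rw [Finset.eventually_all]
    intro s hs
    simpa using (hlow s hs).eventually (Metric.ball_mem_nhds 0 hε)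
  have h2 : ∀ᶠ i in atTop, ‖q i ^ (D + 1) • w - θ‖ < ε := by
    simpa [dist_eq_norm] using htop.eventually (Metric.ball_mem_nhds θ hε)
  obtain ⟨i, hi1, hi2, hi3⟩ := (h1.and (h2.and (hq.eventually_ge_atTop A))).exists
  exact ⟨q i, hi3, hi1, hi2⟩

lemma DensePowers.succ_of_forall_isTopLimit {w : G} {D : ℕ} (hD : DensePowers w D)
    (h : ∀ θ, IsTopLimit w D θ) : DensePowers w (D + 1) := by
  intro x ε hε A
  obtain ⟨a, -, ha⟩ := hD x (ε / 2) (half_pos hε) 0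
  obtain ⟨n, hn, hlow, htop⟩ :=
    (h (x (D + 1) - a ^ (D + 1) • w)).exists_shift a (half_pos hε) A
  refine ⟨n, hn, fun s hs => ?_⟩
  by_cases hsD : s = D + 1
  · subst hsD
    rw [sub_sub_sub_cancel_right] at htop
    linarith
  · have hs' : s ∈ Finset.Icc 1 D := by simp only [Finset.mem_Icc] at *; omega
    have := norm_add_le (n ^ s • w - a ^ s • w) (a ^ s • w - x s)
    rw [sub_add_sub_cancel] at this
    linarith [hlow s hs', ha s hs']

end PolynomialOrbits

section Circle

lemma exists_pos_nsmul_norm_lt (θ : UnitAddCircle) {ε : ℝ} (hε : 0 < ε) :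
    ∃ j : ℕ, 1 ≤ j ∧ ‖j • θ‖ < ε := by
  obtain ⟨n, hn⟩ := exists_nat_one_div_lt hε
  obtain ⟨j, hj, hle⟩ := AddCircle.exists_norm_nsmul_le θ (Nat.succ_pos n)
  refine ⟨j, hj.1, hle.trans_lt (lt_of_le_of_lt ?_ hn)⟩
  push_cast
  gcongr
  linarith

lemma IsTopLimit.neg {w θ : UnitAddCircle} {D : ℕ} (h : IsTopLimit w D θ) :
    IsTopLimit w D (-θ) := by
  refine .of_forall_near fun ε hε => ?_
  obtain ⟨j, hj, hlt⟩ := exists_pos_nsmul_norm_lt θ (half_pos hε)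
  obtain ⟨i, rfl⟩ := Nat.exists_eq_add_of_le' hj
  refine ⟨(2 * i + 1) • θ - 0, by simpa using h.nsmul_succ (2 * i), ?_⟩
  rw [show (2 * i + 1) • θ - 0 - -θ = (i + 1) • θ + (i + 1) • θ by
    rw [sub_zero, sub_neg_eq_add, ← succ_nsmul, ← add_nsmul]; congr 1; ring]
  exact (norm_add_le _ _).trans_lt (by linarith)

lemma densePowers_one {w : UnitAddCircle} (hw : DenseRange fun n : ℤ => n • w) :
    DensePowers w 1 := by
  intro x ε hε A
  obtain ⟨k, hk⟩ := hw.exists_dist_lt (x 1) (half_pos hε)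
  set B : ℕ := A + k.natAbs with hB
  obtain ⟨j, hj, hlt⟩ := exists_pos_nsmul_norm_lt w (ε := ε / (2 * (B + 1))) (by positivity)
  have hBj : B ≤ B * j := Nat.le_mul_of_pos_right _ hj
  obtain ⟨n, hn⟩ : ∃ n : ℕ, (n : ℤ) = k + (B * j : ℕ) :=
    ⟨(k + (B * j : ℕ)).toNat, by omega⟩
  refine ⟨n, by omega, fun s hs => ?_⟩
  obtain rfl : s = 1 := by simpa using hs
  have h1 : ‖B • (j • w)‖ < ε / 2 := by
    refine norm_nsmul_le.trans_lt ?_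
    calc (B : ℝ) * ‖j • w‖ ≤ B * (ε / (2 * (B + 1))) := by gcongr
      _ < ε / 2 := by field_simp; linarith
  rw [pow_one, ← natCast_zsmul, hn, add_smul, natCast_zsmul, mul_smul]
  rw [dist_comm, dist_eq_norm] at hk
  calc _ = ‖(k • w - x 1) + B • (j • w)‖ := by congr 1; abel
    _ < ε := (norm_add_le _ _).trans_lt (by linarith)

lemma DensePowers.exists_increment {w : UnitAddCircle} {D : ℕ} (hD1 : 1 ≤ D)
    (hD : DensePowers w D) (t : ℝ) (N : ℕ) :
    ∃ a m : ℕ, N ≤ a ∧ N ≤ m ∧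
      (∀ s ∈ Finset.Icc 1 D, ‖a ^ s • w‖ ≤ (2 + D * |t|) / (N + 1)) ∧
      (∀ s ∈ Finset.Icc 1 D, ‖m ^ s • w‖ ≤ (2 + D * |t|) / (N + 1)) ∧
      (∀ s ∈ Finset.Icc 1 D, ‖(a + m) ^ s • w‖ ≤ (2 + D * |t|) / (N + 1)) ∧
      ‖(a + m) ^ (D + 1) • w - a ^ (D + 1) • w - m ^ (D + 1) • w
        - (D + 1) • (t : UnitAddCircle)‖ ≤ (2 + D * |t|) / (N + 1) := by
  have hη : (0 : ℝ) < 1 / (N + 1) := by positivity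
  obtain ⟨a, haN, ha⟩ := hD 0 _ hη (N + 1)
  simp only [Pi.zero_apply, sub_zero] at ha
  have haN' : (N : ℝ) + 1 ≤ a := by exact_mod_cast haN
  have ha0 : (0 : ℝ) < a := by linarith [Nat.cast_nonneg (α := ℝ) N]
  set y : ℝ := t / a ^ D with hy
  set δ : ℝ := 1 / (N + 1) / (a + 1) ^ (D + 1) with hδ
  have hδ0 : 0 < δ := by positivity
  let z : ℕ → UnitAddCircle := fun j => if j = 1 then (y : UnitAddCircle) else 0
  obtain ⟨m, hmN, hm⟩ := hD z δ hδ0 N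
  have hKη : 1 / ((N : ℝ) + 1) + 1 / (N + 1) + D * |t| / (N + 1) = (2 + D * |t|) / (N + 1) := by
    field_simp; ring
  have hpow : ∀ s ≤ D + 1, ((a : ℝ) + 1) ^ s * δ ≤ 1 / (N + 1) := by
    intro s hs
    rw [hδ, mul_div_assoc', div_le_iff₀ (by positivity), mul_comm]
    gcongr
    linarith
  have hta : |t| / a ≤ |t| / (N + 1) := by gcongr
  have hya : ∀ s ∈ Finset.Icc 1 D, ‖(a ^ (s - 1) * s) • (y : UnitAddCircle)‖ ≤ D * |t| / (N + 1) := by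
    intro s hs
    obtain ⟨hs1, hsD⟩ := Finset.mem_Icc.1 hs
    calc ‖(a ^ (s - 1) * s) • (y : UnitAddCircle)‖ 
        = ‖(((a : ℝ) ^ (s - 1) * s * y : ℝ) : UnitAddCircle)‖ := by
          rw [← AddCircle.coe_nsmul, nsmul_eq_mul]; push_cast; rfl
      _ ≤ ‖(a : ℝ) ^ (s - 1) * s * y‖ := QuotientAddGroup.norm_mk_le_norm
      _ = s * (a ^ (s - 1) * (|t| / a ^ D)) := by
          rw [hy, norm_mul, norm_mul, norm_div, norm_pow, norm_pow]
          simp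
          ring
      _ ≤ D * (a ^ (D - 1) * (|t| / a ^ D)) := by
          gcongr
          linarith [Nat.cast_nonneg (α := ℝ) N]
      _ = D * (|t| / a) := by
          obtain ⟨E, rfl⟩ := Nat.exists_eq_add_of_le' hD1
          simp only [Nat.add_sub_cancel]
          field_simp
          ring
      _ ≤ _ := by rw [mul_div_assoc]; gcongr
  have hsum : ∀ s ∈ Finset.Icc 1 D, ∀ r,
      ∑ j ∈ Finset.Icc 1 s, (a ^ (r - j) * r.choose j) • z j
        = (a ^ (r - 1) * r) • (y : UnitAddCircle) := by
    intro s hs r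
    rw [Finset.sum_eq_single 1 (fun j _ hj => by simp [z, hj])
      (fun h => absurd (Finset.mem_Icc.2 ⟨le_rfl, (Finset.mem_Icc.1 hs).1⟩) h)]
    simp [z]
  have hDD : (0 : ℝ) ≤ D * |t| / (N + 1) := by positivity
  refine ⟨a, m, by omega, hmN, fun s hs => ?_, fun s hs => ?_, fun s hs => ?_, ?_⟩
  · linarith [ha s hs]
  · have hzs : ‖z s‖ ≤ D * |t| / (N + 1) := by
      by_cases h1 : s = 1
      · simpa [h1, z] using hya 1 (by simpa using hD1)
      · simpa [h1, z] using hDD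
    have h2 := norm_add_le (m ^ s • w - z s) (z s)
    rw [sub_add_cancel] at h2
    have h3 := hpow 0 (Nat.zero_le _)
    rw [pow_zero, one_mul] at h3
    linarith [hm s hs]
  · obtain ⟨hs1, hsD⟩ := Finset.mem_Icc.1 hs
    have h1 := norm_add_pow_nsmul_sub_le w z a m hs1 (δ := δ) fun j hj =>
      (hm j (by simp only [Finset.mem_Icc] at *; omega)).le
    rw [hsum s hs] at h1
    have h2 := norm_add₃_le (a := (a + m) ^ s • w - a ^ s • w - (a ^ (s - 1) * s) • (y : UnitAddCircle))
      (b := a ^ s • w) (c := (a ^ (s - 1) * s) • (y : UnitAddCircle))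
    rw [show ∀ p q r : UnitAddCircle, p - q - r + q + r = p by intros; abel] at h2
    linarith [hpow s (by omega), ha s hs, hya s hs]
  · have h1 := norm_add_pow_nsmul_sub_le w
      (fun j => if j = D + 1 then m ^ (D + 1) • w else z j) a m (Nat.le_add_left 1 D) (δ := δ)
      fun j hj => by
        split_ifs with hjD
        · simpa [hjD] using hδ0.le
        · exact (hm j (by simp only [Finset.mem_Icc] at *; omega)).le
    rw [Finset.sum_Icc_succ_top (by omega), if_pos rfl, Finset.sum_congr rfl fun j hj => by
      rw [if_neg (by simp only [Finset.mem_Icc] at hj; omega)], hsum D (by simpa using hD1),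
      Nat.sub_self, pow_zero, Nat.choose_self, mul_one, one_smul] at h1
    have h2 : (a ^ (D + 1 - 1) * (D + 1)) • (y : UnitAddCircle) = (D + 1) • (t : UnitAddCircle) := by
      rw [Nat.add_sub_cancel, mul_comm, mul_smul, ← AddCircle.coe_nsmul (n := a ^ D), nsmul_eq_mul,
        hy]
      congr 2
      push_cast
      field_simp
    rw [h2, add_comm ((D + 1) • (t : UnitAddCircle)), ← sub_sub] at h1
    linarith [hpow (D + 1) le_rfl]

lemma DensePowers.isTopLimit {w : UnitAddCircle} {D : ℕ} (hD1 : 1 ≤ D)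
    (hD : DensePowers w D) (θ : UnitAddCircle) : IsTopLimit w D θ := by
  obtain ⟨r, rfl⟩ := QuotientAddGroup.mk_surjective θ
  set t : ℝ := r / (D + 1) with ht
  have htr : ((r : ℝ) : UnitAddCircle) = (D + 1) • (t : UnitAddCircle) := by
    rw [← AddCircle.coe_nsmul, nsmul_eq_mul, ht]
    congr 1
    push_cast
    field_simp
  choose a m haN hmN ha hm ham htop using hD.exists_increment hD1 t
  obtain ⟨⟨u, v⟩, φ, hφ, huv⟩ :=
    SeqCompactSpace.tendsto_subseq fun N => (a N ^ (D + 1) • w, m N ^ (D + 1) • w)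
  rw [nhds_prod_eq, tendsto_prod_iff'] at huv
  obtain ⟨hu, hv⟩ := huv
  have hsmall : Tendsto (fun N : ℕ => (2 + D * |t|) / ((φ N : ℝ) + 1)) atTop (𝓝 0) := by
    have := (tendsto_one_div_add_atTop_nhds_zero_nat (𝕜 := ℝ)).const_mul (2 + D * |t|)
    simp only [mul_one_div, mul_zero] at this
    exact this.comp hφ.tendsto_atTop
  have haφ : Tendsto (a ∘ φ) atTop atTop :=
    tendsto_atTop_mono (fun N => haN (φ N)) hφ.tendsto_atTop
  have hmφ : Tendsto (m ∘ φ) atTop atTop :=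
    tendsto_atTop_mono (fun N => hmN (φ N)) hφ.tendsto_atTop
  have hU : IsTopLimit w D u := .of_tendsto haφ
    (fun s hs => squeeze_zero_norm (fun N => ha (φ N) s hs) hsmall) hu
  have hV : IsTopLimit w D v := .of_tendsto hmφ
    (fun s hs => squeeze_zero_norm (fun N => hm (φ N) s hs) hsmall) hv
  have hW : IsTopLimit w D (u + v + (r : UnitAddCircle)) := by
    refine .of_tendsto (q := fun N => a (φ N) + m (φ N))
      (tendsto_atTop_mono (fun N => Nat.le_add_right _ _) haφ)
      (fun s hs => squeeze_zero_norm (fun N => ham (φ N) s hs) hsmall) ?_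
    have h1 := squeeze_zero_norm (fun N => htop (φ N)) hsmall
    have h2 := (h1.add_const ((D + 1) • (t : UnitAddCircle))).add (hu.add hv)
    rw [zero_add, ← htr, add_comm (r : UnitAddCircle)] at h2
    refine h2.congr fun N => ?_
    simp only [Function.comp]
    abel
  have := hW.add (hU.add hV).neg
  rwa [show u + v + (r : UnitAddCircle) + -(u + v) = r by abel] at this

/-- Weyl: for irrational `w` the points `(n • w, …, n ^ d • w)` are dense in the torus. -/
lemma densePowers_of_denseRange {w : UnitAddCircle} (hw : DenseRange fun n : ℤ => n • w) (d : ℕ)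
    (hd : 1 ≤ d) : DensePowers w d := by
  induction d, hd using Nat.le_induction with
  | base => exact densePowers_one hw
  | succ D hD1 ih => exact ih.succ_of_forall_isTopLimit (ih.isTopLimit hD1)

lemma DensePowers.exists_tendsto {G : Type*} [SeminormedAddCommGroup G] {w : G} {d : ℕ}
    (h : DensePowers w d) (x : ℕ → G) :
    ∃ p : ℕ → ℕ, ∀ s ∈ Finset.Icc 1 d, Tendsto (fun i => p i ^ s • w) atTop (𝓝 (x s)) := by
  choose p _ hp using fun i : ℕ => h x (1 / ((i : ℝ) + 1)) (by positivity) 0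
  refine ⟨p, fun s hs => ?_⟩
  rw [tendsto_iff_norm_sub_tendsto_zero]
  exact squeeze_zero (fun _ => norm_nonneg _) (fun i => (hp i s hs).le)
    tendsto_one_div_add_atTop_nhds_zero_nat

end Circle

section Phases

lemma e_eq_toCircle (t : ℝ) : e t = (AddCircle.toCircle (t : UnitAddCircle) : ℂ) := by
  rw [AddCircle.toCircle_apply_mk, Circle.coe_exp, e]
  congr 1
  push_cast
  ring

lemma tendsto_e_one {f : ℕ → ℝ} (h : Tendsto (fun i => (f i : UnitAddCircle)) atTop (𝓝 0)) :
    Tendsto (fun i => e (f i)) atTop (𝓝 1) := by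
  have h1 : Continuous fun x : UnitAddCircle => (AddCircle.toCircle x : ℂ) :=
    continuous_subtype_val.comp AddCircle.continuous_toCircle
  have h2 := (h1.tendsto 0).comp h
  simp only [AddCircle.toCircle_zero, Circle.coe_one] at h2
  exact h2.congr fun i => (e_eq_toCircle _).symm

lemma coe_mul_natCast_pow (ω : ℝ) (n k : ℕ) :
    ((ω * (n : ℝ) ^ k : ℝ) : UnitAddCircle) = n ^ k • (ω : UnitAddCircle) := by
  rw [← AddCircle.coe_nsmul, nsmul_eq_mul, mul_comm]
  push_cast
  rfl

/-- Along suitable even shifts, the phase `ω n ^ k` acquires an arbitrary linear term `θ n`. -/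
lemma exists_even_shifts {ω : ℝ} (hω : Irrational ω) {k : ℕ} (hk : 2 ≤ k) (θ : ℝ) :
    ∃ p : ℕ → ℕ, ∀ j : ℕ, Tendsto (fun i => e (ω * ((j + 2 * p i : ℕ) : ℝ) ^ k
      - ω * ((2 * p i : ℕ) : ℝ) ^ k - ω * (j : ℝ) ^ k - j * θ)) atTop (𝓝 1) := by
  obtain ⟨D, rfl⟩ := Nat.exists_eq_add_of_le' (one_le_two.trans hk)
  have hD : 1 ≤ D := by omega
  set w : UnitAddCircle := (ω : UnitAddCircle) with hw
  have hdense : DenseRange fun n : ℤ => n • w :=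
    AddCircle.denseRange_zsmul_coe_iff.2 (by simpa using hω)
  set τ : ℝ := θ / ((D + 1) * 2 ^ D) with hτ
  let x : ℕ → UnitAddCircle := fun s => if s = D then (τ : UnitAddCircle) else 0
  obtain ⟨p, hp⟩ := (densePowers_of_denseRange hdense D hD).exists_tendsto x
  refine ⟨p, fun j => tendsto_e_one ?_⟩
  have hr : Finset.range (D + 1) = insert 0 (Finset.Icc 1 D) := by
    ext; simp; omega
  have hexp : ∀ q : ℕ, (j + 2 * q) ^ (D + 1) • w - (2 * q) ^ (D + 1) • w - j ^ (D + 1) • w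
      = ∑ s ∈ Finset.Icc 1 D, (2 ^ s * j ^ (D + 1 - s) * (D + 1).choose s) • (q ^ s • w) := by
    intro q
    rw [add_comm j, add_pow, Finset.sum_range_succ, hr, Finset.sum_insert (by simp), add_smul,
      add_smul, Finset.sum_smul]
    simp only [Nat.choose_zero_right, Nat.choose_self, pow_zero, one_mul, mul_one, Nat.sub_self,
      Nat.sub_zero, Nat.cast_one]
    rw [add_sub_cancel_right, add_sub_cancel_left]
    refine Finset.sum_congr rfl fun s _ => ?_
    rw [← mul_smul]
    congr 1
    simp only [Nat.cast_id]
    ring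
  have hlim : Tendsto (fun i => ∑ s ∈ Finset.Icc 1 D,
      (2 ^ s * j ^ (D + 1 - s) * (D + 1).choose s) • (p i ^ s • w)) atTop
      (𝓝 (((j * θ : ℝ) : UnitAddCircle))) := by
    have : ((j * θ : ℝ) : UnitAddCircle)
        = ∑ s ∈ Finset.Icc 1 D, (2 ^ s * j ^ (D + 1 - s) * (D + 1).choose s) • x s := by
      rw [Finset.sum_eq_single D (fun s _ hs => by simp [x, hs]) (by simp; omega)]
      simp only [x, if_true]
      rw [← AddCircle.coe_nsmul, nsmul_eq_mul, hτ]
      congr 1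
      simp
      field_simp
    rw [this]
    exact tendsto_finsetSum _ fun s hs => ((continuous_nsmul _).tendsto _).comp (hp s hs)
  have := hlim.sub_const ((j * θ : ℝ) : UnitAddCircle)
  rw [sub_self] at this
  refine this.congr fun i => ?_
  rw [← hexp, AddCircle.coe_sub, AddCircle.coe_sub, AddCircle.coe_sub, coe_mul_natCast_pow,
    coe_mul_natCast_pow, coe_mul_natCast_pow]

end Phases

section Averaging

open Finset in
lemma sum_rootsOfUnity_pow {ζ : ℂ} {n : ℕ} (hζ : IsPrimitiveRoot ζ n) {j l : ℕ} (hj : j < n)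
    (hl : l < n) : ∑ t ∈ range n, conj ((ζ ^ t) ^ j) * (ζ ^ t) ^ l = if j = l then (n : ℂ) else 0 := by
  have hn : n ≠ 0 := by omega
  have hζ1 : ‖ζ‖ = 1 := hζ.norm'_eq_one hn
  have hζc : conj ζ * ζ = 1 := by rw [mul_comm, Complex.mul_conj']; simp [hζ1]
  have hterm : ∀ t, conj ((ζ ^ t) ^ j) * (ζ ^ t) ^ l = (conj ζ ^ j * ζ ^ l) ^ t := by
    intro t
    simp only [map_pow, mul_pow, ← pow_mul]
    rw [mul_comm t j, mul_comm t l]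
  simp only [hterm]
  split_ifs with h
  · subst h
    simp [← mul_pow, hζc]
  · have hne : conj ζ ^ j * ζ ^ l ≠ 1 := by
      intro h1
      apply h
      refine hζ.pow_inj hj hl ?_
      calc ζ ^ j = ζ ^ j * (conj ζ ^ j * ζ ^ l) := by rw [h1, mul_one]
        _ = (conj ζ * ζ) ^ j * ζ ^ l := by ring
        _ = ζ ^ l := by rw [hζc, one_pow, one_mul]
    have hpow : (conj ζ ^ j * ζ ^ l) ^ n = 1 := by
      rw [mul_pow, ← pow_mul, ← pow_mul, mul_comm j, mul_comm l, pow_mul, pow_mul, ← map_pow,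
        hζ.pow_eq_one]
      simp
    have := geom_sum_mul (conj ζ ^ j * ζ ^ l) n
    rw [hpow, sub_self] at this
    exact (mul_eq_zero.1 this).resolve_right (sub_ne_zero.2 hne)

variable {H : Type*} [NormedAddCommGroup H] [InnerProductSpace ℂ H]

open Finset in
/-- A trigonometric polynomial with vector coefficients is somewhere at least as large as its
root mean square. -/
lemma exists_norm_one_sum_sq_le_norm_sq (v : ℕ → H) {n : ℕ} (hn : n ≠ 0) :
    ∃ w : ℂ, ‖w‖ = 1 ∧ ∑ j ∈ range n, ‖v j‖ ^ 2 ≤ ‖∑ j ∈ range n, w ^ j • v j‖ ^ 2 := by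
  have hζ := Complex.isPrimitiveRoot_exp n hn
  set ζ := Complex.exp (2 * Real.pi * Complex.I / n) with hζdef
  have hsum : ∑ t ∈ range n, ‖∑ j ∈ range n, (ζ ^ t) ^ j • v j‖ ^ 2
      = ∑ t ∈ range n, ∑ j ∈ range n, ‖v j‖ ^ 2 := by
    have h : ((∑ t ∈ range n, ‖∑ j ∈ range n, (ζ ^ t) ^ j • v j‖ ^ 2 : ℝ) : ℂ)
        = ((∑ t ∈ range n, ∑ j ∈ range n, ‖v j‖ ^ 2 : ℝ) : ℂ) := by
      push_cast
      have h1 : ∀ x : H, ((‖x‖ : ℂ)) ^ 2 = inner ℂ x x := fun x =>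
        (inner_self_eq_norm_sq_to_K (𝕜 := ℂ) x).symm
      simp only [h1, sum_inner, inner_sum, inner_smul_left, inner_smul_right]
      rw [sum_comm, sum_const, card_range, nsmul_eq_mul, mul_sum]
      refine sum_congr rfl fun j hj => ?_
      simp only [mul_sum]
      rw [sum_comm]
      calc _ = ∑ l ∈ range n, (if l = j then (n : ℂ) else 0) * inner ℂ (v l) (v j) := by
            refine sum_congr rfl fun l hl => ?_
            rw [← sum_rootsOfUnity_pow hζ (mem_range.1 hl) (mem_range.1 hj), sum_mul]
            exact sum_congr rfl fun t _ => by ring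
        _ = _ := by
            rw [sum_eq_single j (fun l _ hl => by simp [hl]) (fun h => absurd hj h)]
            simp
    exact_mod_cast h
  obtain ⟨t, -, ht⟩ := exists_le_of_sum_le (by simpa using hn) hsum.ge
  exact ⟨ζ ^ t, by rw [norm_pow, hζ.norm'_eq_one hn, one_pow], ht⟩

/-- An isometry admits no lower bound for `1 - w • C`, uniform over the circle, on a subspace
containing arbitrarily long orbits. -/
lemma false_of_uniform_lower_bound (C : H →L[ℂ] H) (hC : ∀ x, ‖C x‖ = ‖x‖) (V : Submodule ℂ H)
    (horbit : ∀ n : ℕ, ∃ x : H, ‖x‖ = 1 ∧ ∀ j < n, (C ^ j) x ∈ V) (K : ℝ)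
    (hK : ∀ x ∈ V, ∀ w : ℂ, ‖w‖ = 1 → ‖x‖ ≤ K * ‖x - w • C x‖) : False := by
  have hCpow : ∀ (j : ℕ) (x : H), ‖(C ^ j) x‖ = ‖x‖ := by
    intro j x
    induction j with
    | zero => simp
    | succ j ih => rw [pow_succ', mul_apply_eq_comp, hC, ih]
  obtain ⟨n, hn⟩ := exists_nat_gt ((2 * |K|) ^ 2)
  have hn0 : n ≠ 0 := by rintro rfl; simp at hn; nlinarith [sq_nonneg K]
  obtain ⟨x, hx, hxV⟩ := horbit n
  obtain ⟨w, hw, hle⟩ := exists_norm_one_sum_sq_le_norm_sq (fun j => (C ^ j) x) hn0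
  set φ := ∑ j ∈ Finset.range n, w ^ j • (C ^ j) x with hφ
  simp only [hCpow, hx, one_pow, Finset.sum_const, Finset.card_range, nsmul_eq_mul, mul_one] at hle
  have hφV : φ ∈ V := V.sum_mem fun j hj => V.smul_mem _ (hxV j (Finset.mem_range.1 hj))
  have htel : φ - w • C φ = x - w ^ n • (C ^ n) x := by
    have hgeom : φ = (∑ j ∈ Finset.range n, (w • C) ^ j) x := by
      rw [hφ, sum_apply]
      exact Finset.sum_congr rfl fun j _ => by rw [smul_pow]; rfl
    have := congrArg (fun T : H →L[ℂ] H => T x) (mul_neg_geom_sum (w • C) n)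
    rw [smul_pow] at this
    rw [hgeom]
    exact this
  have h2 : ‖φ - w • C φ‖ ≤ 2 := by
    rw [htel]
    refine (norm_sub_le _ _).trans ?_
    rw [norm_smul, norm_pow, hw, hCpow, hx]
    norm_num
  have h3 : ‖φ‖ ≤ 2 * |K| := by
    refine (hK φ hφV w hw).trans ?_
    nlinarith [le_abs_self K, abs_nonneg K, norm_nonneg (φ - w • C φ)]
  have : ‖φ‖ ^ 2 ≤ (2 * |K|) ^ 2 := by gcongr
  linarith

end Averaging

section SequenceSpace

/-- The Hilbert space `ℓ²(ℕ, ℂ)`. -/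
abbrev SeqSpace := lp (fun _ : ℕ => ℂ) 2

/-- The `n`-th standard basis vector of `ℓ²(ℕ, ℂ)`. -/
def delta (n : ℕ) : SeqSpace := lp.single 2 n (1 : ℂ)

lemma delta_apply (n m : ℕ) : delta n m = if m = n then 1 else 0 := by
  rw [delta, lp.single_apply, Pi.single_apply]

lemma norm_delta (n : ℕ) : ‖delta n‖ = 1 := by
  rw [delta, lp.norm_single (by norm_num), norm_one]

lemma inner_delta (n m : ℕ) : inner ℂ (delta n) (delta m) = if n = m then (1 : ℂ) else 0 := by
  have := lp.inner_single_left (𝕜 := ℂ) n (1 : ℂ) (delta m)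
  rw [← delta, delta_apply] at this
  simpa using this

lemma topologicalClosure_span_delta : (Submodule.span ℂ (Set.range delta)).topologicalClosure = ⊤ := by
  rw [eq_top_iff]
  intro x _
  have h := lp.hasSum_single (p := 2) (by norm_num) x
  refine mem_closure_of_tendsto h (Eventually.of_forall fun s => ?_)
  refine Submodule.sum_mem _ fun n _ => ?_
  have : lp.single 2 n (x n) = (x n) • delta n := by
    rw [delta, ← lp.single_smul, smul_eq_mul, mul_one]
  rw [this]
  exact Submodule.smul_mem _ _ (Submodule.subset_span ⟨n, rfl⟩)

lemma norm_sq_eq_tsum (x : SeqSpace) : ‖x‖ ^ 2 = ∑' n, ‖x n‖ ^ 2 := by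
  simpa using lp.norm_rpow_eq_tsum (p := 2) (by norm_num) x

lemma summable_norm_sq (x : SeqSpace) : Summable fun n => ‖x n‖ ^ 2 := by
  simpa using (lp.hasSum_norm (p := 2) (by norm_num) x).summable

/-- The isometry of `ℓ²(ℕ, ℂ)` that modulates by `u` and then shifts by `q`. -/
def modShift (u : ℕ → Circle) (q : ℕ) : SeqSpace →ₗᵢ[ℂ] SeqSpace :=
  (show OrthogonalFamily ℂ (fun _ : ℕ => ℂ) fun n =>
      LinearIsometry.toSpanSingleton ℂ SeqSpace (v := (u n : ℂ) • delta (n + q))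
        (by rw [norm_smul, norm_delta, mul_one, Circle.norm_coe]) by
    intro n m hnm x y
    simp [inner_smul_left, inner_smul_right, inner_delta, hnm]).linearIsometry

lemma modShift_delta (u : ℕ → Circle) (q n : ℕ) :
    modShift u q (delta n) = (u n : ℂ) • delta (n + q) := by
  rw [modShift, delta, OrthogonalFamily.linearIsometry_apply_single]
  simp

/-- `U` acts on the coordinates `n`, `n + 1` through the matrix `[[conj a, r], [r, -a]]`. -/
def ActsOnPair (U : SeqSpace →L[ℂ] SeqSpace) (a r : ℂ) (n : ℕ) : Prop :=
  U (delta n) = conj a • delta n + r • delta (n + 1) ∧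
    U (delta (n + 1)) = r • delta n - a • delta (n + 1)

lemma ActsOnPair.mem_range {U : SeqSpace →L[ℂ] SeqSpace} {a r : ℂ} {n : ℕ}
    (h : ActsOnPair U a r n) (har : a * conj a + r ^ 2 = 1) :
    delta n ∈ LinearMap.range U.toLinearMap ∧ delta (n + 1) ∈ LinearMap.range U.toLinearMap := by
  refine ⟨⟨a • delta n + r • delta (n + 1), ?_⟩, ⟨r • delta n - conj a • delta (n + 1), ?_⟩⟩
  · simp only [ContinuousLinearMap.coe_coe, map_add, map_smul, h.1, h.2]
    conv_rhs => rw [← one_smul ℂ (delta n), ← har]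
    module
  · simp only [ContinuousLinearMap.coe_coe, map_sub, map_smul, h.1, h.2]
    conv_rhs => rw [← one_smul ℂ (delta (n + 1)), ← har]
    module

lemma surjective_of_delta_mem_range {U : SeqSpace →L[ℂ] SeqSpace} (hU : ∀ x, ‖U x‖ = ‖x‖)
    (h : ∀ n, delta n ∈ LinearMap.range U.toLinearMap) : Function.Surjective U := by
  let U' : SeqSpace →ₗᵢ[ℂ] SeqSpace := ⟨U.toLinearMap, hU⟩
  have hcl : IsClosed (Set.range U) := U'.isometry.isClosedEmbedding.isClosed_range
  have hspan : Submodule.span ℂ (Set.range delta) ≤ LinearMap.range U.toLinearMap :=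
    Submodule.span_le.2 (Set.range_subset_iff.2 h)
  intro y
  have hy : y ∈ (Submodule.span ℂ (Set.range delta)).topologicalClosure := by
    rw [topologicalClosure_span_delta]; trivial
  exact Submodule.topologicalClosure_minimal (t := LinearMap.range U.toLinearMap) _ hspan
    (by simpa [LinearMap.coe_range] using hcl) hy

/-- If `α (n + q i)` is asymptotic to a rotation of `α n`, then modulated shifts compatible with
this rotation asymptotically intertwine a block-diagonal operator with itself. -/
lemma ActsOnPair.tendsto_intertwine {U : SeqSpace →L[ℂ] SeqSpace} {α : ℕ → ℂ} {r : ℂ} {n : ℕ}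
    {q : ℕ → ℕ} {A B : ℕ → ℕ → Circle} {γ : ℕ → Circle} {κ : Circle}
    (h : ActsOnPair U (α n) r n) (hq : ∀ i, ActsOnPair U (α (n + q i)) r (n + q i))
    (hA : ∀ i, A i n = κ * B i (n + 1)) (hA' : ∀ i, A i (n + 1) = κ * B i n)
    (hγ : ∀ i, A i (n + 1) * γ i = A i n)
    (hlim : Tendsto (fun i => α (n + q i) - γ i * α n) atTop (𝓝 0)) :
    Tendsto (fun i => U (modShift (A i) (q i) (delta n))
        - (κ : ℂ) • modShift (B i) (q i) (U (delta n))) atTop (𝓝 0) ∧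
      Tendsto (fun i => U (modShift (A i) (q i) (delta (n + 1)))
        - (κ : ℂ) • modShift (B i) (q i) (U (delta (n + 1)))) atTop (𝓝 0) := by
  rw [tendsto_zero_iff_norm_tendsto_zero] at hlim
  have hshift : ∀ i, n + 1 + q i = n + q i + 1 := fun i => by omega
  have hA₁ : ∀ i, (A i n : ℂ) = κ * B i (n + 1) := fun i => by rw [hA]; simp
  have hA₂ : ∀ i, (A i (n + 1) : ℂ) = κ * B i n := fun i => by rw [hA']; simp
  have hγ₁ : ∀ i, (A i (n + 1) : ℂ) * γ i = A i n := fun i => by rw [← hγ i]; simp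
  have hγ₂ : ∀ i, (A i n : ℂ) * conj (γ i : ℂ) = A i (n + 1) := fun i => by
    rw [← hγ₁, mul_assoc, Complex.mul_conj', Circle.norm_coe]
    simp
  constructor
  · refine squeeze_zero_norm (fun i => le_of_eq ?_) hlim
    have : U (modShift (A i) (q i) (delta n)) - (κ : ℂ) • modShift (B i) (q i) (U (delta n))
        = ((A i n : ℂ) * conj (α (n + q i) - γ i * α n)) • delta (n + q i) := by
      rw [modShift_delta, map_smul, (hq i).1, h.1, map_add, map_smul, map_smul, modShift_delta,
        modShift_delta, hshift, map_sub, map_mul, mul_sub, ← mul_assoc, hγ₂, hA₁, hA₂]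
      module
    rw [this, norm_smul, norm_mul, norm_delta, Circle.norm_coe, one_mul, mul_one, RCLike.norm_conj]
  · refine squeeze_zero_norm (fun i => le_of_eq ?_) hlim
    have : U (modShift (A i) (q i) (delta (n + 1)))
        - (κ : ℂ) • modShift (B i) (q i) (U (delta (n + 1)))
        = (-(A i (n + 1) : ℂ) * (α (n + q i) - γ i * α n)) • delta (n + q i + 1) := by
      rw [modShift_delta, map_smul, hshift, (hq i).2, h.2, map_sub, map_smul, map_smul,
        modShift_delta, modShift_delta, hshift, mul_sub, ← mul_assoc, neg_mul _ (γ i : ℂ), hγ₁,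
        hA₁, hA₂]
      module
    rw [this, norm_smul, norm_mul, norm_neg, norm_delta, Circle.norm_coe, one_mul, mul_one]

end SequenceSpace

section HalfLine

/-- The point `exp (2πi t)` of the unit circle. -/
def circ (t : ℝ) : Circle := Circle.exp (2 * Real.pi * t)

lemma circ_add (s t : ℝ) : circ (s + t) = circ s * circ t := by
  rw [circ, mul_add, Circle.exp_add]; rfl

lemma coe_circ (t : ℝ) : (circ t : ℂ) = e t := by
  rw [circ, Circle.coe_exp, e]
  congr 1
  push_cast
  ring

lemma exists_circ_eq {z : ℂ} (hz : ‖z‖ = 1) : ∃ t, (circ t : ℂ) = z :=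
  ⟨Complex.arg z / (2 * Real.pi), by
    rw [circ, mul_div_cancel₀ _ (by positivity), Circle.coe_exp]
    simpa [hz] using Complex.norm_mul_exp_arg_mul_I z⟩

/-- The phases `a` for which `modShift a` intertwines `ℒ₊ ∘ ℳ₊` with its rotation by `θ`. -/
def sourcePhase (θ c : ℝ) (n : ℕ) : Circle :=
  if Even n then circ (-((n / 2 : ℕ) * θ)) else circ (c + (n / 2 : ℕ) * θ)

/-- The intermediate phases, between `ℳ₊` and `ℒ₊`. -/
def targetPhase (θ c : ℝ) (n : ℕ) : Circle :=
  if Even n then circ (c + (n / 2 : ℕ) * θ) else circ (-((n / 2 : ℕ) * θ))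

lemma sourcePhase_even (θ c : ℝ) (m : ℕ) : sourcePhase θ c (2 * m) = circ (-(m * θ)) := by
  simp [sourcePhase]

lemma sourcePhase_odd (θ c : ℝ) (m : ℕ) : sourcePhase θ c (2 * m + 1) = circ (c + m * θ) := by
  simp [sourcePhase, show (2 * m + 1) / 2 = m by omega]

lemma targetPhase_even (θ c : ℝ) (m : ℕ) : targetPhase θ c (2 * m) = circ (c + m * θ) := by
  simp [targetPhase]

lemma targetPhase_odd (θ c : ℝ) (m : ℕ) : targetPhase θ c (2 * m + 1) = circ (-(m * θ)) := by
  simp [targetPhase, show (2 * m + 1) / 2 = m by omega]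

/-- The vectors spanned by the basis vectors of index at least `a`. -/
def farSpan (a : ℕ) : Submodule ℂ SeqSpace := Submodule.span ℂ (delta '' Set.Ici a)

lemma delta_mem_farSpan {a n : ℕ} (h : a ≤ n) : delta n ∈ farSpan a :=
  Submodule.subset_span ⟨n, h, rfl⟩

lemma ActsOnPair.mem_farSpan {U : SeqSpace →L[ℂ] SeqSpace} {a r : ℂ} {n b : ℕ}
    (h : ActsOnPair U a r n) (hb : b ≤ n) :
    U (delta n) ∈ farSpan b ∧ U (delta (n + 1)) ∈ farSpan b := by
  have h1 := delta_mem_farSpan hb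
  have h2 := delta_mem_farSpan (hb.trans n.le_succ)
  rw [h.1, h.2]
  exact ⟨add_mem (Submodule.smul_mem _ _ h1) (Submodule.smul_mem _ _ h2),
    sub_mem (Submodule.smul_mem _ _ h1) (Submodule.smul_mem _ _ h2)⟩

lemma map_mem_of_mem_farSpan {U : SeqSpace →L[ℂ] SeqSpace} {a : ℕ} {V : Submodule ℂ SeqSpace}
    (h : ∀ n ≥ a, U (delta n) ∈ V) {x : SeqSpace} (hx : x ∈ farSpan a) : U x ∈ V := by
  have : farSpan a ≤ V.comap U.toLinearMap := by
    refine Submodule.span_le.2 ?_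
    rintro _ ⟨n, hn, rfl⟩
    exact h n hn
  exact this hx

lemma tendsto_zero_of_mem_farSpan {a : ℕ} {F : ℕ → SeqSpace →ₗ[ℂ] SeqSpace}
    (h : ∀ n ≥ a, Tendsto (fun i => F i (delta n)) atTop (𝓝 0)) {x : SeqSpace}
    (hx : x ∈ farSpan a) : Tendsto (fun i => F i x) atTop (𝓝 0) := by
  refine Submodule.span_induction (p := fun x _ => Tendsto (fun i => F i x) atTop (𝓝 0))
    ?_ ?_ ?_ ?_ hx
  · rintro _ ⟨n, hn, rfl⟩
    exact h n hn
  · simp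
  · intro x y _ _ hx hy
    simpa using hx.add hy
  · intro b x _ hx
    simpa using hx.const_smul b

section Pairs

variable {L M : SeqSpace →L[ℂ] SeqSpace} {α : ℕ → ℂ} {r : ℂ}

lemma even_pairs_map_mem_farSpan
    (hL : ∀ m, ActsOnPair L (α (2 * m)) r (2 * m))
    {a : ℕ} {x : SeqSpace} (hx : x ∈ farSpan (a + 1)) :
    L x ∈ farSpan a := by
  refine map_mem_of_mem_farSpan (fun n hn => ?_) hx
  obtain ⟨m, rfl | rfl⟩ := Nat.even_or_odd' n
  · exact ((hL m).mem_farSpan (by omega)).1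
  · exact ((hL m).mem_farSpan (by omega)).2

lemma odd_pairs_map_mem_farSpan
    (hM : ∀ m, ActsOnPair M (α (2 * m + 1)) r (2 * m + 1))
    {a : ℕ} {x : SeqSpace} (hx : x ∈ farSpan (a + 1)) :
    M x ∈ farSpan a := by
  refine map_mem_of_mem_farSpan (fun n hn => ?_) hx
  obtain ⟨l, rfl⟩ := Nat.exists_eq_add_of_le' (show 1 ≤ n by omega)
  obtain ⟨m, rfl | rfl⟩ := Nat.even_or_odd' l
  · exact ((hM m).mem_farSpan (by omega)).1
  · exact ((hM m).mem_farSpan (by omega)).2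

lemma pow_map_mem_farSpan
    (hL : ∀ m, ActsOnPair L (α (2 * m)) r (2 * m))
    (hM : ∀ m, ActsOnPair M (α (2 * m + 1)) r (2 * m + 1))
    (j : ℕ) {a : ℕ} {x : SeqSpace} (hx : x ∈ farSpan (a + 2 * j)) :
    ((L.comp M) ^ j) x ∈ farSpan a := by
  induction j generalizing a with
  | zero => simpa using hx
  | succ j ih =>
    rw [pow_succ', mul_apply_eq_comp]
    refine even_pairs_map_mem_farSpan hL (odd_pairs_map_mem_farSpan hM (ih ?_))
    convert hx using 2
    ring

lemma tendsto_cmv_intertwine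
    (hL : ∀ m, ActsOnPair L (α (2 * m)) r (2 * m))
    (hM : ∀ m, ActsOnPair M (α (2 * m + 1)) r (2 * m + 1))
    {θ : ℝ} {p : ℕ → ℕ} {c : ℕ → ℝ}
    (hlim : ∀ n, Tendsto (fun i => α (n + 2 * p i) - circ (c i + n * θ) * α n) atTop (𝓝 0))
    {x : SeqSpace} (hx : x ∈ farSpan 1) :
    Tendsto (fun i => L.comp M (modShift (sourcePhase θ (c i)) (2 * p i) x)
      - (circ (-θ) : ℂ) • modShift (sourcePhase θ (c i)) (2 * p i) (L.comp M x)) atTop (𝓝 0) := by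
  let S : ℕ → SeqSpace →ₗᵢ[ℂ] SeqSpace := fun i => modShift (sourcePhase θ (c i)) (2 * p i)
  let T : ℕ → SeqSpace →ₗᵢ[ℂ] SeqSpace := fun i => modShift (targetPhase θ (c i)) (2 * p i)
  have hLT : ∀ y ∈ farSpan 0, Tendsto (fun i => L (T i y) - S i (L y)) atTop (𝓝 0) := by
    intro y hy
    refine tendsto_zero_of_mem_farSpan (F := fun i =>
      L.toLinearMap ∘ₗ (T i).toLinearMap - (S i).toLinearMap ∘ₗ L.toLinearMap) (fun n _ => ?_) hy
    have key : ∀ m, _ := fun m => (hL m).tendsto_intertwine (q := fun i => 2 * p i)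
      (A := fun i => targetPhase θ (c i)) (B := fun i => sourcePhase θ (c i)) (κ := 1)
      (γ := fun i => circ (c i + (2 * m : ℕ) * θ))
      (fun i => by
        have := hL (m + p i)
        rwa [mul_add] at this)
      (fun i => by rw [targetPhase_even, sourcePhase_odd, one_mul])
      (fun i => by rw [targetPhase_odd, sourcePhase_even, one_mul])
      (fun i => by
        rw [targetPhase_even, targetPhase_odd, ← circ_add]
        congr 1
        push_cast
        ring)
      (hlim _)
    obtain ⟨m, rfl | rfl⟩ := Nat.even_or_odd' n
    · simpa using (key m).1
    · simpa using (key m).2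
  have hMS : Tendsto (fun i => M (S i x) - (circ (-θ) : ℂ) • T i (M x)) atTop (𝓝 0) := by
    refine tendsto_zero_of_mem_farSpan (F := fun i =>
      M.toLinearMap ∘ₗ (S i).toLinearMap
        - (circ (-θ) : ℂ) • (T i).toLinearMap ∘ₗ M.toLinearMap) (fun n hn => ?_) hx
    have key : ∀ m, _ := fun m => (hM m).tendsto_intertwine (q := fun i => 2 * p i)
      (A := fun i => sourcePhase θ (c i)) (B := fun i => targetPhase θ (c i)) (κ := circ (-θ))
      (γ := fun i => circ (c i + (2 * m + 1 : ℕ) * θ))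
      (fun i => by
        have := hM (m + p i)
        rwa [show 2 * (m + p i) + 1 = 2 * m + 1 + 2 * p i by ring] at this)
      (fun i => by
        rw [show 2 * m + 1 + 1 = 2 * (m + 1) by ring, targetPhase_even, sourcePhase_odd, ← circ_add]
        congr 1
        push_cast
        ring)
      (fun i => by
        rw [show 2 * m + 1 + 1 = 2 * (m + 1) by ring, targetPhase_odd, sourcePhase_even, ← circ_add]
        congr 1
        push_cast
        ring)
      (fun i => by
        rw [show 2 * m + 1 + 1 = 2 * (m + 1) by ring, sourcePhase_even, sourcePhase_odd, ← circ_add]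
        congr 1
        push_cast
        ring)
      (hlim _)
    obtain ⟨l, rfl⟩ := Nat.exists_eq_add_of_le' hn
    obtain ⟨m, rfl | rfl⟩ := Nat.even_or_odd' l
    · simpa using (key m).1
    · simpa using (key m).2
  have h1 := (L.continuous.tendsto 0).comp hMS
  have h2 := (hLT (M x) (odd_pairs_map_mem_farSpan hM hx)).const_smul (circ (-θ) : ℂ)
  rw [map_zero] at h1
  rw [smul_zero] at h2
  have h3 := h1.add h2
  rw [add_zero] at h3
  refine h3.congr fun i => ?_
  simp only [Function.comp, map_sub, map_smul, smul_sub, sub_add_sub_cancel]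
  rfl

/-- If the coefficients reproduce themselves, up to arbitrary linear phases, along even shifts,
then the spectrum of an isometric `ℒ₊ ∘ ℳ₊` contains the unit circle. -/
lemma mem_spectrum_of_forall_shift
    (hL : ∀ m, ActsOnPair L (α (2 * m)) r (2 * m))
    (hM : ∀ m, ActsOnPair M (α (2 * m + 1)) r (2 * m + 1))
    (hiso : ∀ x, ‖L.comp M x‖ = ‖x‖)
    (hshift : ∀ θ : ℝ, ∃ (p : ℕ → ℕ) (c : ℕ → ℝ), ∀ n,
      Tendsto (fun i => α (n + 2 * p i) - circ (c i + n * θ) * α n) atTop (𝓝 0))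
    {z : ℂ} (hz : ‖z‖ = 1) : z ∈ spectrum ℂ (L.comp M) := by
  set C := L.comp M with hC
  by_contra hns
  rw [spectrum.mem_iff, not_not] at hns
  obtain ⟨u, hu⟩ := hns
  set R : SeqSpace →L[ℂ] SeqSpace := ↑u⁻¹ with hR
  have hRu : ∀ y, R (z • y - C y) = y := by
    intro y
    have h : R * (algebraMap ℂ _ z - C) = 1 := by rw [← hu, hR, Units.inv_mul]
    have := congrArg (fun T : SeqSpace →L[ℂ] SeqSpace => T y) h
    simpa [Algebra.algebraMap_eq_smul_one] using this
  refine false_of_uniform_lower_bound C hiso (farSpan 1) (fun n => ⟨delta (1 + 2 * n),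
    norm_delta _, fun j hj => pow_map_mem_farSpan hL hM j (delta_mem_farSpan (by omega))⟩) ‖R‖ ?_
  intro x hx w hw
  obtain ⟨t, ht⟩ := exists_circ_eq (z := w * z) (by rw [norm_mul, hw, hz, mul_one])
  obtain ⟨p, c, hlim⟩ := hshift (-t)
  have hT := (tendsto_cmv_intertwine hL hM hlim hx).norm
  rw [norm_zero, neg_neg, ht] at hT
  have hbound := (hT.const_add ‖x - w • C x‖).const_mul ‖R‖
  rw [add_zero] at hbound
  refine ge_of_tendsto' hbound fun i => ?_
  set T := modShift (sourcePhase (-t) (c i)) (2 * p i) with hTdef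
  have hsplit : z • T x - C (T x) = z • T (x - w • C x) - (C (T x) - (w * z) • T (C x)) := by
    rw [map_sub, map_smul]
    module
  calc ‖x‖ = ‖R (z • T x - C (T x))‖ := by rw [hRu, T.norm_map]
    _ ≤ ‖R‖ * ‖z • T x - C (T x)‖ := R.le_opNorm _
    _ ≤ _ := by
      gcongr
      rw [hsplit]
      refine (norm_sub_le _ _).trans ?_
      rw [norm_smul, hz, one_mul, T.norm_map]

end Pairs

end HalfLine

section CMV

lemma norm_e (t : ℝ) : ‖e t‖ = 1 := by rw [← coe_circ, Circle.norm_coe]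

lemma mul_conj_add_rhoN_sq {α : ℕ → ℂ} {n : ℕ} (h : ‖α n‖ ≤ 1) :
    α n * conj (α n) + rhoN α n ^ 2 = 1 := by
  rw [Complex.mul_conj', rhoN, ← Complex.ofReal_pow (Real.sqrt _),
    Real.sq_sqrt (sub_nonneg.2 (pow_le_one₀ (norm_nonneg _) h))]
  push_cast
  ring

lemma norm_sq_add_norm_sq_pair {α : ℕ → ℂ} {n : ℕ} (h : ‖α n‖ ≤ 1) (x y : ℂ) :
    ‖conj (α n) * x + rhoN α n * y‖ ^ 2 + ‖rhoN α n * x - α n * y‖ ^ 2 = ‖x‖ ^ 2 + ‖y‖ ^ 2 := by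
  have hr : conj (rhoN α n) = rhoN α n := Complex.conj_ofReal _
  apply Complex.ofReal_injective
  push_cast
  simp only [← Complex.mul_conj', map_add, map_sub, map_mul, Complex.conj_conj, hr]
  linear_combination (x * conj x + y * conj y) * mul_conj_add_rhoN_sq h

lemma tsum_eq_tsum_of_pairs {f g : ℕ → ℝ} (hf : Summable f) (hg : Summable g)
    (h : ∀ m, f (2 * m) + f (2 * m + 1) = g (2 * m) + g (2 * m + 1)) :
    ∑' n, f n = ∑' n, g n := by
  have he : Function.Injective fun m : ℕ => 2 * m := fun a b h => by simpa using h
  have ho : Function.Injective fun m : ℕ => 2 * m + 1 := fun a b h => by simpa using h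
  have hfe := hf.comp_injective he
  have hfo := hf.comp_injective ho
  have hge := hg.comp_injective he
  have hgo := hg.comp_injective ho
  rw [← tsum_even_add_odd hfe hfo, ← tsum_even_add_odd hge hgo]
  exact (hfe.tsum_add hfo).symm.trans ((tsum_congr h).trans (hge.tsum_add hgo))

lemma norm_eq_of_tsum_eq {x y : SeqSpace} (h : ∑' n, ‖x n‖ ^ 2 = ∑' n, ‖y n‖ ^ 2) :
    ‖x‖ = ‖y‖ := by
  rw [← norm_sq_eq_tsum, ← norm_sq_eq_tsum] at h
  exact (sq_eq_sq₀ (norm_nonneg _) (norm_nonneg _)).1 h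

section EvenFactor

variable {α : ℕ → ℂ} {L : SeqSpace →L[ℂ] SeqSpace}

lemma norm_map_of_even_pairs (hα : ∀ n, ‖α n‖ ≤ 1)
    (hL : ∀ (ψ : SeqSpace) (m : ℕ),
      (L ψ) (2 * m) = conj (α (2 * m)) * ψ (2 * m) + rhoN α (2 * m) * ψ (2 * m + 1) ∧
      (L ψ) (2 * m + 1) = rhoN α (2 * m) * ψ (2 * m) - α (2 * m) * ψ (2 * m + 1))
    (ψ : SeqSpace) : ‖L ψ‖ = ‖ψ‖ := by
  refine norm_eq_of_tsum_eq (tsum_eq_tsum_of_pairs (summable_norm_sq _) (summable_norm_sq _)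
    fun m => ?_)
  rw [(hL ψ m).1, (hL ψ m).2]
  exact norm_sq_add_norm_sq_pair (hα _) _ _

lemma actsOnPair_of_even_pairs
    (hL : ∀ (ψ : SeqSpace) (m : ℕ),
      (L ψ) (2 * m) = conj (α (2 * m)) * ψ (2 * m) + rhoN α (2 * m) * ψ (2 * m + 1) ∧
      (L ψ) (2 * m + 1) = rhoN α (2 * m) * ψ (2 * m) - α (2 * m) * ψ (2 * m + 1))
    (m : ℕ) : ActsOnPair L (α (2 * m)) (rhoN α (2 * m)) (2 * m) := by
  constructor <;> ext j <;> obtain ⟨p, rfl | rfl⟩ := Nat.even_or_odd' j <;>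
    obtain rfl | hp := eq_or_ne p m
  all_goals
    simp only [(hL _ _).1, (hL _ _).2, lp.coeFn_add, lp.coeFn_sub, lp.coeFn_smul, Pi.add_apply,
      Pi.sub_apply, Pi.smul_apply, smul_eq_mul, delta_apply]
    grind

end EvenFactor

section OddFactor

variable {α : ℕ → ℂ} {M : SeqSpace →L[ℂ] SeqSpace}

lemma norm_map_of_odd_pairs (hα : ∀ n, ‖α n‖ ≤ 1) (hM0 : ∀ ψ : SeqSpace, (M ψ) 0 = ψ 0)
    (hM : ∀ (ψ : SeqSpace) (m : ℕ),
      (M ψ) (2 * m + 1)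
        = conj (α (2 * m + 1)) * ψ (2 * m + 1) + rhoN α (2 * m + 1) * ψ (2 * m + 2) ∧
      (M ψ) (2 * m + 2)
        = rhoN α (2 * m + 1) * ψ (2 * m + 1) - α (2 * m + 1) * ψ (2 * m + 2))
    (ψ : SeqSpace) : ‖M ψ‖ = ‖ψ‖ := by
  refine norm_eq_of_tsum_eq ?_
  have hs := summable_norm_sq (M ψ)
  have hs' := summable_norm_sq ψ
  rw [hs.tsum_eq_zero_add, hs'.tsum_eq_zero_add, hM0]
  congr 1
  refine tsum_eq_tsum_of_pairs ((summable_nat_add_iff 1).2 hs) ((summable_nat_add_iff 1).2 hs')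
    fun m => ?_
  rw [(hM ψ m).1, (hM ψ m).2]
  exact norm_sq_add_norm_sq_pair (hα _) _ _

lemma actsOnPair_of_odd_pairs (hM0 : ∀ ψ : SeqSpace, (M ψ) 0 = ψ 0)
    (hM : ∀ (ψ : SeqSpace) (m : ℕ),
      (M ψ) (2 * m + 1)
        = conj (α (2 * m + 1)) * ψ (2 * m + 1) + rhoN α (2 * m + 1) * ψ (2 * m + 2) ∧
      (M ψ) (2 * m + 2)
        = rhoN α (2 * m + 1) * ψ (2 * m + 1) - α (2 * m + 1) * ψ (2 * m + 2))
    (m : ℕ) : ActsOnPair M (α (2 * m + 1)) (rhoN α (2 * m + 1)) (2 * m + 1) := by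
  constructor <;> ext j <;> obtain _ | l := j <;>
    [skip; (obtain ⟨p, rfl | rfl⟩ := Nat.even_or_odd' l <;> obtain rfl | hp := eq_or_ne p m);
     skip; (obtain ⟨p, rfl | rfl⟩ := Nat.even_or_odd' l <;> obtain rfl | hp := eq_or_ne p m)]
  all_goals
    simp only [hM0, (hM _ _).1, (hM _ _).2, lp.coeFn_add, lp.coeFn_sub, lp.coeFn_smul,
      Pi.add_apply, Pi.sub_apply, Pi.smul_apply, smul_eq_mul, delta_apply]
    grind

lemma map_delta_zero_of_odd_pairs (hM0 : ∀ ψ : SeqSpace, (M ψ) 0 = ψ 0)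
    (hM : ∀ (ψ : SeqSpace) (m : ℕ),
      (M ψ) (2 * m + 1)
        = conj (α (2 * m + 1)) * ψ (2 * m + 1) + rhoN α (2 * m + 1) * ψ (2 * m + 2) ∧
      (M ψ) (2 * m + 2)
        = rhoN α (2 * m + 1) * ψ (2 * m + 1) - α (2 * m + 1) * ψ (2 * m + 2)) :
    M (delta 0) = delta 0 := by
  ext j
  obtain _ | l := j
  · exact hM0 _
  · obtain ⟨p, rfl | rfl⟩ := Nat.even_or_odd' l
    · simp [(hM _ _).1, delta_apply]
    · simp [(hM _ _).2, delta_apply]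

end OddFactor

lemma spectrum_subset_circle {U : SeqSpace →L[ℂ] SeqSpace} (hU : ∀ x, ‖U x‖ = ‖x‖)
    (hsurj : Function.Surjective U) : spectrum ℂ U ⊆ {z : ℂ | ‖z‖ = 1} := by
  let V : SeqSpace ≃ₗᵢ[ℂ] SeqSpace :=
    LinearIsometryEquiv.ofSurjective ⟨U.toLinearMap, hU⟩ hsurj
  have hV : ((Unitary.linearIsometryEquiv.symm V : unitary (SeqSpace →L[ℂ] SeqSpace)) :
      SeqSpace →L[ℂ] SeqSpace) = U := by
    ext1 x
    rfl
  intro z hz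
  rw [← hV] at hz
  simpa using spectrum.subset_circle_of_unitary (Subtype.prop _) hz

lemma exists_shifts_coeff {lam : ℂ} {ω : ℝ} (hω : Irrational ω) {k : ℕ} (hk : 2 ≤ k)
    {α : ℕ → ℂ} (hα : ∀ n : ℕ, α n = lam * e (ω * (n : ℝ) ^ k)) (θ : ℝ) :
    ∃ (p : ℕ → ℕ) (c : ℕ → ℝ), ∀ n,
      Tendsto (fun i => α (n + 2 * p i) - circ (c i + n * θ) * α n) atTop (𝓝 0) := by
  obtain ⟨p, hp⟩ := exists_even_shifts hω hk θ
  refine ⟨p, fun i => ω * ((2 * p i : ℕ) : ℝ) ^ k, fun n => ?_⟩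
  have h := (tendsto_iff_norm_sub_tendsto_zero.1 (hp n)).const_mul ‖lam‖
  rw [mul_zero] at h
  refine squeeze_zero_norm (fun i => le_of_eq ?_) h
  set s := ω * ((2 * p i : ℕ) : ℝ) ^ k + n * θ
  set d := ω * ((n + 2 * p i : ℕ) : ℝ) ^ k - ω * ((2 * p i : ℕ) : ℝ) ^ k - ω * (n : ℝ) ^ k - n * θ
    with hd
  have hadd : e (ω * ((n + 2 * p i : ℕ) : ℝ) ^ k) = e s * e (ω * (n : ℝ) ^ k) * e d := by
    simp only [← coe_circ, ← Circle.coe_mul, ← circ_add]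
    congr 2
    ring
  rw [hα, hα, hadd, coe_circ,
    show lam * (e s * e (ω * (n : ℝ) ^ k) * e d) - e s * (lam * e (ω * (n : ℝ) ^ k))
      = e s * e (ω * (n : ℝ) ^ k) * (lam * (e d - 1)) by ring]
  simp [norm_e]

end CMV

/-- For Verblunsky coefficients `α_n = λ e(ω n^k)` with `0 < |λ| < 1`,
`ω` irrational and `k ≥ 2`, the spectrum of the associated half-line CMV operator
`𝒞 = ℒ₊ ∘ ℳ₊` is the whole unit circle. -/
theorem stmt0 (lam : ℂ) (hlam0 : lam ≠ 0) (hlam1 : ‖lam‖ < 1)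
    (ω : ℝ) (hω : Irrational ω) (k : ℕ) (hk : 2 ≤ k)
    (α : ℕ → ℂ) (hα : ∀ n : ℕ, α n = lam * e (ω * (n : ℝ) ^ k))
    (L M : lp (fun _ : ℕ => ℂ) 2 →L[ℂ] lp (fun _ : ℕ => ℂ) 2)
    (hL : ∀ (ψ : lp (fun _ : ℕ => ℂ) 2) (m : ℕ),
      (L ψ) (2 * m) = conj (α (2 * m)) * ψ (2 * m) + rhoN α (2 * m) * ψ (2 * m + 1) ∧
      (L ψ) (2 * m + 1) = rhoN α (2 * m) * ψ (2 * m) - α (2 * m) * ψ (2 * m + 1))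
    (hM0 : ∀ ψ : lp (fun _ : ℕ => ℂ) 2, (M ψ) 0 = ψ 0)
    (hM : ∀ (ψ : lp (fun _ : ℕ => ℂ) 2) (m : ℕ),
      (M ψ) (2 * m + 1)
        = conj (α (2 * m + 1)) * ψ (2 * m + 1) + rhoN α (2 * m + 1) * ψ (2 * m + 2) ∧
      (M ψ) (2 * m + 2)
        = rhoN α (2 * m + 1) * ψ (2 * m + 1) - α (2 * m + 1) * ψ (2 * m + 2)) :
    spectrum ℂ (L.comp M) = {z : ℂ | ‖z‖ = 1} := by
  have hnorm : ∀ n, ‖α n‖ = ‖lam‖ := fun n => by rw [hα, norm_mul, norm_e, mul_one]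
  have hα1 : ∀ n, ‖α n‖ ≤ 1 := fun n => (hnorm n).trans_le hlam1.le
  have hrho : ∀ n, rhoN α n = rhoN α 0 := fun n => by rw [rhoN, rhoN, hnorm, hnorm]
  have hLn := norm_map_of_even_pairs hα1 hL
  have hMn := norm_map_of_odd_pairs hα1 hM0 hM
  have hLp := actsOnPair_of_even_pairs hL
  have hMp := actsOnPair_of_odd_pairs hM0 hM
  have hLs : Function.Surjective L := surjective_of_delta_mem_range hLn fun n => by
    obtain ⟨m, rfl | rfl⟩ := Nat.even_or_odd' n
    · exact ((hLp m).mem_range (mul_conj_add_rhoN_sq (hα1 _))).1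
    · exact ((hLp m).mem_range (mul_conj_add_rhoN_sq (hα1 _))).2
  have hMs : Function.Surjective M := surjective_of_delta_mem_range hMn fun n => by
    obtain _ | l := n
    · exact ⟨delta 0, map_delta_zero_of_odd_pairs hM0 hM⟩
    · obtain ⟨m, rfl | rfl⟩ := Nat.even_or_odd' l
      · exact ((hMp m).mem_range (mul_conj_add_rhoN_sq (hα1 _))).1
      · exact ((hMp m).mem_range (mul_conj_add_rhoN_sq (hα1 _))).2
  have hiso : ∀ x, ‖L.comp M x‖ = ‖x‖ := fun x => (hLn (M x)).trans (hMn x)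
  refine Set.Subset.antisymm (spectrum_subset_circle hiso (hLs.comp hMs)) fun z hz => ?_
  refine mem_spectrum_of_forall_shift (r := rhoN α 0) (fun m => ?_) (fun m => ?_) hiso
    (exists_shifts_coeff hω hk hα) hz
  · rw [← hrho (2 * m)]
    exact hLp m
  · rw [← hrho (2 * m + 1)]
    exact hMp m
end
end

section
/- Let α : ℤ → ℂ with |α n| < 1, let z ∈ ℂ, and let ψ : ℤ → ℂ satisfy the whole-line equation (z·𝓛* − 𝓜)ψ = 0 entrywise (each row of the tridiagonal matrix z·𝓛* − 𝓜 applied to ψ vanishes). Let a < b be integers, β, γ ∈ ∂𝔻, set A = z·(ℒ^{[a,b]}_{β,γ})* − ℳ^{[a,b]}_{β,γ}, and assume A is invertible. Then for every n with a < n < b, ψ(n) = G^{[a,b]}_{β,γ}(z; n, a)·(A·ψ|_{[a,b]})(a) + G^{[a,b]}_{β,γ}(z; n, b)·(A·ψ|_{[a,b]})(b), where ψ|_{[a,b]} is the restriction of ψ to coordinates {a, …, b}. -/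
open scoped ComplexConjugate Matrix

noncomputable section

namespace CMV

/-- `ρ n = (1 - |α n|^2)^{1/2}`, as a complex number. -/
def rho (α : ℤ → ℂ) (n : ℤ) : ℂ := ((1 - ‖α n‖ ^ 2).sqrt : ℝ)

/-- Entries of the doubly infinite matrix `𝓛 = ⊕_{n even} Θ n`. -/
def cmvL (α : ℤ → ℂ) (i j : ℤ) : ℂ :=
  if Even i ∧ j = i then conj (α i)
  else if Even i ∧ j = i + 1 then rho α i
  else if Even j ∧ i = j + 1 then rho α j
  else if Odd i ∧ j = i then -α (i - 1)
  else 0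

/-- Entries of the doubly infinite matrix `𝓜 = ⊕_{n odd} Θ n`. -/
def cmvM (α : ℤ → ℂ) (i j : ℤ) : ℂ :=
  if Odd i ∧ j = i then conj (α i)
  else if Odd i ∧ j = i + 1 then rho α i
  else if Odd j ∧ i = j + 1 then rho α j
  else if Even i ∧ j = i then -α (i - 1)
  else 0

/-- Coefficients modified at both boundaries: `α̃ (a-1) = β`, `α̃ b = γ`. -/
def modA (α : ℤ → ℂ) (a b : ℤ) (β γ : ℂ) (n : ℤ) : ℂ :=
  if n = a - 1 then β else if n = b then γ else α n

/-- Principal submatrix of `𝓛` on rows and columns `{a, …, b}`. -/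
def subL (αm : ℤ → ℂ) (a b : ℤ) : Matrix (Set.Icc a b) (Set.Icc a b) ℂ :=
  fun i j => cmvL αm i j

/-- Principal submatrix of `𝓜` on rows and columns `{a, …, b}`. -/
def subM (αm : ℤ → ℂ) (a b : ℤ) : Matrix (Set.Icc a b) (Set.Icc a b) ℂ :=
  fun i j => cmvM αm i j

end CMV

open CMV

namespace CMV

/-- Column `m` of `𝓛` only involves the coefficients at `m - 1` and `m`. -/
theorem cmvL_col_congr {α α' : ℤ → ℂ} {m : ℤ} (h₁ : α (m - 1) = α' (m - 1)) (h₂ : α m = α' m)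
    (j : ℤ) : cmvL α j m = cmvL α' j m := by
  by_cases hj : m = j
  · subst hj
    simp [cmvL, h₁, h₂]
  by_cases hj₁ : m = j + 1
  · obtain rfl : j = m - 1 := by lia
    simp [cmvL, rho, h₁, h₂, hj]
  · simp [cmvL, rho, hj, hj₁, h₂]

/-- Row `m` of `𝓜` only involves the coefficients at `m - 1` and `m`. -/
theorem cmvM_row_congr {α α' : ℤ → ℂ} {m : ℤ} (h₁ : α (m - 1) = α' (m - 1)) (h₂ : α m = α' m)
    (j : ℤ) : cmvM α m j = cmvM α' m j := by
  by_cases hj : m = j + 1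
  · obtain rfl : j = m - 1 := by lia
    simp [cmvM, rho, h₁, h₂]
  · simp [cmvM, rho, hj, h₁, h₂]

theorem cmvL_eq_zero (α : ℤ → ℂ) {i j : ℤ} (h : i + 1 < j ∨ j + 1 < i) : cmvL α i j = 0 := by
  have h₁ : j ≠ i := by lia
  have h₂ : j ≠ i + 1 := by lia
  have h₃ : i ≠ j + 1 := by lia
  simp [cmvL, h₁, h₂, h₃]

theorem cmvM_eq_zero (α : ℤ → ℂ) {i j : ℤ} (h : i + 1 < j ∨ j + 1 < i) : cmvM α i j = 0 := by
  have h₁ : j ≠ i := by lia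
  have h₂ : j ≠ i + 1 := by lia
  have h₃ : i ≠ j + 1 := by lia
  simp [cmvM, h₁, h₂, h₃]

/-- The modification at the boundary does not affect the interior rows: there the truncated
operator annihilates restrictions of whole-line solutions. -/
theorem mulVec_restrict_eq_zero {α : ℤ → ℂ} {z : ℂ} {ψ : ℤ → ℂ} {a b : ℤ} (β γ : ℂ)
    (i : Set.Icc a b) (ha : a < i) (hb : i < b)
    (hψ : ∑ j ∈ Finset.Icc ((i : ℤ) - 1) (i + 1),
      (z * conj (cmvL α j i) - cmvM α i j) * ψ j = 0) :
    (z • (subL (modA α a b β γ) a b)ᴴ - subM (modA α a b β γ) a b).mulVec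
      (fun j => ψ j) i = 0 := by
  have h₁ : modA α a b β γ ((i : ℤ) - 1) = α (i - 1) := by
    rw [modA, if_neg (by lia), if_neg (by lia)]
  have h₂ : modA α a b β γ i = α i := by
    rw [modA, if_neg (by lia), if_neg (by lia)]
  let f : ℤ → ℂ := fun j => (z * conj (cmvL α j i) - cmvM α i j) * ψ j
  calc _ = ∑ j : Set.Icc a b, f j := by
        simp [Matrix.mulVec, dotProduct, subL, subM, f, cmvL_col_congr h₁ h₂,
          cmvM_row_congr h₁ h₂]
    _ = ∑ j ∈ Finset.Icc a b, f j :=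
        (Finset.sum_subtype (Finset.Icc a b) (by simp) f).symm
    _ = ∑ j ∈ Finset.Icc ((i : ℤ) - 1) (i + 1), f j := by
        refine (Finset.sum_subset (Finset.Icc_subset_Icc (by lia) (by lia)) ?_).symm
        intro j _ hj
        rw [Finset.mem_Icc] at hj
        simp [f, cmvL_eq_zero α (i := j) (j := i) (by lia),
          cmvM_eq_zero α (i := i) (j := j) (by lia)]
    _ = 0 := hψ

end CMV

/-- If `ψ` solves the whole-line equation `(z 𝓛^* − 𝓜) ψ = 0`
entrywise (the rows of the tridiagonal matrix `z 𝓛^* − 𝓜` applied to `ψ` vanish),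
`a < b`, `β, γ ∈ ∂𝔻`, and `A = z (ℒ^{[a,b]}_{β,γ})^* − ℳ^{[a,b]}_{β,γ}` is
invertible, then for `a < n < b`,
`ψ(n) = G(z;n,a)·(A ψ|_{[a,b]})(a) + G(z;n,b)·(A ψ|_{[a,b]})(b)`. -/
theorem stmt6 (α : ℤ → ℂ) (hα : ∀ n, ‖α n‖ < 1) (z : ℂ) (ψ : ℤ → ℂ)
    (hψ : ∀ n : ℤ, ∑ j ∈ Finset.Icc (n - 1) (n + 1),
      (z * conj (cmvL α j n) - cmvM α n j) * ψ j = 0)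
    (a b : ℤ) (hab : a < b) (β γ : ℂ) (hβ : ‖β‖ = 1) (hγ : ‖γ‖ = 1)
    (A : Matrix (Set.Icc a b) (Set.Icc a b) ℂ)
    (hA : A = z • (subL (modA α a b β γ) a b)ᴴ - subM (modA α a b β γ) a b)
    (hinv : IsUnit A.det) :
    ∀ (n : ℤ) (han : a < n) (hnb : n < b),
      ψ n = A⁻¹ ⟨n, Set.mem_Icc.2 ⟨le_of_lt han, le_of_lt hnb⟩⟩
              ⟨a, Set.mem_Icc.2 ⟨le_refl a, le_of_lt hab⟩⟩ *
            (A.mulVec (fun i => ψ i)) ⟨a, Set.mem_Icc.2 ⟨le_refl a, le_of_lt hab⟩⟩ +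
            A⁻¹ ⟨n, Set.mem_Icc.2 ⟨le_of_lt han, le_of_lt hnb⟩⟩
              ⟨b, Set.mem_Icc.2 ⟨le_of_lt hab, le_refl b⟩⟩ *
            (A.mulVec (fun i => ψ i)) ⟨b, Set.mem_Icc.2 ⟨le_of_lt hab, le_refl b⟩⟩ := by
  intro n han hnb
  set v := A.mulVec (fun i : Set.Icc a b => ψ i) with hv
  have hinvv : A⁻¹.mulVec v = fun i : Set.Icc a b => ψ i := by
    rw [hv, Matrix.mulVec_mulVec, Matrix.nonsing_inv_mul A hinv, Matrix.one_mulVec]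
  rw [← congrFun hinvv ⟨n, Set.mem_Icc.2 ⟨han.le, hnb.le⟩⟩]
  refine Finset.sum_eq_add (⟨a, Set.mem_Icc.2 ⟨le_rfl, hab.le⟩⟩ : Set.Icc a b)
    ⟨b, Set.mem_Icc.2 ⟨hab.le, le_rfl⟩⟩ (fun h => hab.ne (Subtype.ext_iff.1 h)) ?_
    (fun h => absurd (Finset.mem_univ _) h) (fun h => absurd (Finset.mem_univ _) h)
  rintro i - ⟨hia, hib⟩
  have ha : a < i := lt_of_le_of_ne i.2.1 fun h => hia (Subtype.ext h.symm)
  have hb : i < b := lt_of_le_of_ne i.2.2 fun h => hib (Subtype.ext h)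
  rw [hv, hA, mulVec_restrict_eq_zero β γ i ha hb (hψ i), mul_zero]
end
end
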